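/- arXiv:2403.04828 — 6 statements merged into one kernel-verified Lean document; each statement's English description precedes it below -/
import Mathlib

section
/- Let ρ_{XY} be a subnormalized quantum state on ℂ^{d_X} ⊗ ℂ^{d_Y} (a positive-semidefinite matrix indexed by pairs of indices, with trace at most 1), and let ρ_Y := tr_X(ρ_{XY}) be its partial trace over the first tensor factor. Then (1/d_X)·ρ_{XY} ≤ I_X ⊗ ρ_Y in the Loewner order, where I_X is the identity matrix on ℂ^{d_X} and ⊗ is the Kronecker product. -/
open Matrix
open scoped ComplexOrder Kronecker

noncomputable section

/-- Real part of the trace. -/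
def trRe {ι : Type*} [Fintype ι] (A : Matrix ι ι ℂ) : ℝ := (A.trace).re

/-- Partial trace over the first tensor factor:
`(tr_X ρ)_{b,b'} = Σ_a ρ_{(a,b),(a,b')}`. -/
def ptraceFst {dX dY : ℕ} (X : Matrix (Fin dX × Fin dY) (Fin dX × Fin dY) ℂ) :
    Matrix (Fin dY) (Fin dY) ℂ :=
  Matrix.of fun b b' => ∑ a : Fin dX, X (a, b) (a, b')

/-- The pinching inequality: `ρ ≤ |ι| · ∑ i, Pᵢᴴ ρ Pᵢ` whenever `∑ i, Pᵢ = 1`. -/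
theorem posSemidef_card_smul_sum_conj_sub {ι n : Type*} [Fintype ι] [Fintype n] [DecidableEq n]
    {ρ : Matrix n n ℂ} (hρ : ρ.PosSemidef) (P : ι → Matrix n n ℂ) (hP : ∑ i, P i = 1) :
    ((Fintype.card ι : ℂ) • ∑ i, (P i)ᴴ * ρ * P i - ρ).PosSemidef := by
  have key : (Fintype.card ι : ℂ) • ∑ i, (P i)ᴴ * ρ * P i - ρ =
      (2⁻¹ : ℂ) • ∑ i, ∑ j, (P i - P j)ᴴ * ρ * (P i - P j) := by
    have hPstar : ∑ i, (P i)ᴴ = 1 := by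
      rw [← conjTranspose_sum, hP, conjTranspose_one]
    have cross : ∑ i, ∑ j, (P i)ᴴ * ρ * P j = ρ := by
      simp_rw [← Finset.mul_sum, hP, ← Finset.sum_mul, hPstar, one_mul, mul_one]
    have cross' : ∑ i, ∑ j, (P j)ᴴ * ρ * P i = ρ := by
      rw [Finset.sum_comm, cross]
    simp only [conjTranspose_sub, sub_mul, mul_sub, Finset.sum_sub_distrib, cross, cross',
      Finset.sum_const, Finset.card_univ, ← Finset.smul_sum, ← Nat.cast_smul_eq_nsmul ℂ]
    module
  rw [key]
  exact (posSemidef_sum _ fun i _ => posSemidef_sum _ fun j _ =>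
    hρ.conjTranspose_mul_mul_same _).smul (by positivity)

/-- The conjugation `(|a⟩⟨a'| ⊗ 1)ᴴ ρ (|a⟩⟨a'| ⊗ 1)` moves the diagonal block `a` of `ρ`
to position `a'`. -/
theorem single_kronecker_conj_apply {α β : Type*} [Fintype α] [Fintype β] [DecidableEq α]
    [DecidableEq β] (ρ : Matrix (α × β) (α × β) ℂ) (a a' : α) (p q : α × β) :
    ((single a a' (1 : ℂ) ⊗ₖ (1 : Matrix β β ℂ))ᴴ * ρ *
      (single a a' (1 : ℂ) ⊗ₖ (1 : Matrix β β ℂ))) p q =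
      if a' = p.1 ∧ a' = q.1 then ρ (a, p.2) (a, q.2) else 0 := by
  rw [conjTranspose_kronecker, conjTranspose_single, conjTranspose_one, star_one]
  obtain ⟨x, y⟩ := p
  obtain ⟨x', y'⟩ := q
  by_cases hx : a' = x <;> by_cases hx' : a' = x' <;>
    simp [mul_apply, Fintype.sum_prod_type, single_apply, one_apply, hx, hx', ite_and]

theorem one_kronecker_ptraceFst {dX dY : ℕ}
    (ρ : Matrix (Fin dX × Fin dY) (Fin dX × Fin dY) ℂ) :
    (1 : Matrix (Fin dX) (Fin dX) ℂ) ⊗ₖ ptraceFst ρ =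
      ∑ a, ∑ a', (single a a' (1 : ℂ) ⊗ₖ (1 : Matrix (Fin dY) (Fin dY) ℂ))ᴴ * ρ *
        (single a a' (1 : ℂ) ⊗ₖ (1 : Matrix (Fin dY) (Fin dY) ℂ)) := by
  ext ⟨x, y⟩ ⟨x', y'⟩
  simp only [Matrix.sum_apply, single_kronecker_conj_apply]
  by_cases h : x = x' <;> simp [ptraceFst, one_apply, h, ite_and]

/-- For a subnormalized state `ρ_{XY}`,
`(1/d_X)·ρ_{XY} ≤ I_X ⊗ ρ_Y` in the Loewner order. -/
theorem stmt2 {dX dY : ℕ} (ρ : Matrix (Fin dX × Fin dY) (Fin dX × Fin dY) ℂ)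
    (hρ : ρ.PosSemidef) (htr : trRe ρ ≤ 1) :
    ((1 : Matrix (Fin dX) (Fin dX) ℂ) ⊗ₖ ptraceFst ρ - ((dX : ℂ))⁻¹ • ρ).PosSemidef := by
  obtain rfl | hd := Nat.eq_zero_or_pos dX
  · rw [Subsingleton.elim (_ - _) (0 : Matrix (Fin 0 × Fin dY) (Fin 0 × Fin dY) ℂ)]
    exact .zero
  let K (a a' : Fin dX) : Matrix (Fin dX × Fin dY) (Fin dX × Fin dY) ℂ := single a a' 1 ⊗ₖ 1
  have hK : ∑ a, K a a = 1 := by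
    ext ⟨x, y⟩ ⟨x', y'⟩
    by_cases h : x = x' <;> simp [K, Matrix.sum_apply, single_apply, one_apply, h, ite_and]
  have hsplit : (1 : Matrix (Fin dX) (Fin dX) ℂ) ⊗ₖ ptraceFst ρ - (dX : ℂ)⁻¹ • ρ =
      ∑ a, ∑ a' ∈ Finset.univ.erase a, (K a a')ᴴ * ρ * K a a' +
        (dX : ℂ)⁻¹ • ((Fintype.card (Fin dX) : ℂ) • ∑ a, (K a a)ᴴ * ρ * K a a - ρ) := by
    have hd' : (dX : ℂ) ≠ 0 := by exact_mod_cast hd.ne'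
    rw [one_kronecker_ptraceFst, Fintype.card_fin, smul_sub, inv_smul_smul₀ hd', ← add_sub_assoc,
      ← Finset.sum_add_distrib]
    congr 1
    exact Finset.sum_congr rfl fun a _ =>
      (Finset.sum_erase_add _ (fun a' => (K a a')ᴴ * ρ * K a a') (Finset.mem_univ a)).symm
  rw [hsplit]
  exact (posSemidef_sum _ fun a _ => posSemidef_sum _ fun a' _ =>
    hρ.conjTranspose_mul_mul_same _).add
      ((posSemidef_card_smul_sum_conj_sub hρ (fun a => K a a) hK).smul (by positivity))

end
end

section
/- Let ρ be a subnormalized quantum state and Γ a positive-semidefinite matrix on ℂ^d, and let ρ' and Γ' be likewise on ℂ^{d'}. Let M, M', and M'' be sets of POVM effects on ℂ^d, ℂ^{d'}, and ℂ^d ⊗ ℂ^{d'} respectively, such that Q ⊗ Q' ∈ M'' (Kronecker product) whenever Q ∈ M and Q' ∈ M'. Then for all η ∈ (0, tr ρ] and η' ∈ (0, tr ρ']: D_{M''}^{ηη'}(ρ⊗ρ' ‖ Γ⊗Γ') ≥ D_M^η(ρ‖Γ) + D_{M'}^{η'}(ρ'‖Γ') (in the extended reals, with the right-hand side interpreted as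 −∞ if either summand is −∞). In particular, H_{M''}^{ηη'}(ρ⊗ρ') ≤ H_M^η(ρ) + H_{M'}^{η'}(ρ'). -/
open Matrix
open scoped ComplexOrder Kronecker

noncomputable section

/-- A POVM effect: `0 ≤ Q ≤ I` in the Loewner order. -/
def IsEffect {ι : Type*} [Fintype ι] [DecidableEq ι] (Q : Matrix ι ι ℂ) : Prop :=
  Q.PosSemidef ∧ (1 - Q).PosSemidef

/-- Complexity relative entropy `D_M^η(ρ‖Γ) := −log( inf { tr(QΓ)/tr(Qρ) : Q ∈ M, tr(Qρ) ≥ η } )`,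
valued in extended reals; the infimum over the empty set is `∞`, so `D = −∞` in that case. -/
def Dc {ι : Type*} [Fintype ι] [DecidableEq ι] (M : Set (Matrix ι ι ℂ))
    (ρ Γ : Matrix ι ι ℂ) (η : ℝ) : EReal :=
  - ENNReal.log (⨅ Q ∈ {Q | Q ∈ M ∧ η ≤ trRe (Q * ρ)},
      ENNReal.ofReal (trRe (Q * Γ) / trRe (Q * ρ)))

/-- Complexity entropy `H_M^η(ρ) := −D_M^η(ρ‖I)`. -/
def Hc {ι : Type*} [Fintype ι] [DecidableEq ι] (M : Set (Matrix ι ι ℂ))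
    (ρ : Matrix ι ι ℂ) (η : ℝ) : EReal :=
  - Dc M ρ 1 η

/-- The trace of a product of two positive-semidefinite matrices is nonnegative. -/
theorem trace_mul_nonneg_of_posSemidef {ι : Type*} [Fintype ι] {A B : Matrix ι ι ℂ}
    (hA : A.PosSemidef) (hB : B.PosSemidef) : 0 ≤ (A * B).trace := by
  classical
  obtain ⟨C, rfl⟩ : ∃ C : Matrix ι ι ℂ, B = Cᴴ * C := by
    open scoped MatrixOrder in
    exact CStarAlgebra.nonneg_iff_eq_star_mul_self.mp hB.nonneg
  rw [← Matrix.mul_assoc, Matrix.trace_mul_comm, ← Matrix.mul_assoc]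
  exact (hA.mul_mul_conjTranspose_same C).trace_nonneg

/-- A subnormalized state is bounded above by the identity in the Loewner order. -/
theorem posSemidef_one_sub_of_trRe_le_one {ι : Type*} [Fintype ι] [DecidableEq ι]
    {ρ : Matrix ι ι ℂ} (hρ : ρ.PosSemidef) (htr : trRe ρ ≤ 1) : (1 - ρ).PosSemidef := by
  open scoped MatrixOrder in
  refine Matrix.le_iff.mp (CFC.le_one (R := ℝ) (fun x hx => ?_) hρ.1)
  rw [hρ.1.spectrum_real_eq_range_eigenvalues] at hx
  obtain ⟨i, rfl⟩ := hx
  have hsum : trRe ρ = ∑ j, hρ.1.eigenvalues j := by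
    simp [trRe, hρ.1.trace_eq_sum_eigenvalues]
  exact (Finset.single_le_sum (fun j _ => hρ.eigenvalues_nonneg j) (Finset.mem_univ i)).trans
    (hsum ▸ htr)

/-- The real part of the trace is multiplicative on Kronecker products when one factor is a product
of positive-semidefinite matrices. -/
theorem trRe_kronecker_mul_kronecker {ι κ : Type*} [Fintype ι] [Fintype κ]
    {Q A : Matrix ι ι ℂ} {Q' A' : Matrix κ κ ℂ} (hQ : Q.PosSemidef) (hA : A.PosSemidef) :
    trRe ((Q ⊗ₖ Q') * (A ⊗ₖ A')) = trRe (Q * A) * trRe (Q' * A') := by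
  have him : (Q * A).trace.im = 0 :=
    (Complex.nonneg_iff.mp (trace_mul_nonneg_of_posSemidef hQ hA)).2.symm
  simp [trRe, ← Matrix.mul_kronecker_mul, Matrix.trace_kronecker, him]

/-- The complexity entropy of a subnormalized state is nonnegative, so `D_M^η(ρ‖I) ≤ 0`. -/
theorem Dc_one_le_zero {ι : Type*} [Fintype ι] [DecidableEq ι] {M : Set (Matrix ι ι ℂ)}
    (hM : ∀ Q ∈ M, IsEffect Q) {ρ : Matrix ι ι ℂ} (hρ : ρ.PosSemidef) (htr : trRe ρ ≤ 1)
    {η : ℝ} (hη : 0 < η) : Dc M ρ 1 η ≤ 0 := by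
  rw [Dc, EReal.neg_le, neg_zero, ENNReal.zero_le_log_iff]
  refine le_iInf₂ fun Q hQ => ?_
  have hpos : 0 < trRe (Q * ρ) := hη.trans_le hQ.2
  rw [ENNReal.one_le_ofReal, one_le_div hpos]
  have h := (Complex.nonneg_iff.mp (trace_mul_nonneg_of_posSemidef (hM Q hQ.1).1
    (posSemidef_one_sub_of_trRe_le_one hρ htr))).1
  simpa [trRe, Matrix.mul_sub] using h

/-- Superadditivity of the complexity relative entropy under tensor products. -/
theorem Dc_add_le_Dc_kronecker {ι κ : Type*} [Fintype ι] [DecidableEq ι] [Fintype κ]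
    [DecidableEq κ] {M : Set (Matrix ι ι ℂ)} {M' : Set (Matrix κ κ ℂ)}
    {M'' : Set (Matrix (ι × κ) (ι × κ) ℂ)} (hM : ∀ Q ∈ M, IsEffect Q)
    (hclose : ∀ Q ∈ M, ∀ Q' ∈ M', Q ⊗ₖ Q' ∈ M'')
    {ρ Γ : Matrix ι ι ℂ} {ρ' Γ' : Matrix κ κ ℂ} (hρ : ρ.PosSemidef) (hΓ : Γ.PosSemidef)
    {η η' : ℝ} (hη : 0 < η) (hη' : 0 < η') :
    Dc M ρ Γ η + Dc M' ρ' Γ' η' ≤ Dc M'' (ρ ⊗ₖ ρ') (Γ ⊗ₖ Γ') (η * η') := by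
  unfold Dc
  set I := ⨅ Q ∈ {Q | Q ∈ M ∧ η ≤ trRe (Q * ρ)},
    ENNReal.ofReal (trRe (Q * Γ) / trRe (Q * ρ)) with hI
  set I' := ⨅ Q ∈ {Q | Q ∈ M' ∧ η' ≤ trRe (Q * ρ')},
    ENNReal.ofReal (trRe (Q * Γ') / trRe (Q * ρ')) with hI'
  by_cases hItop : I = ⊤
  · simp [hItop]
  by_cases hItop' : I' = ⊤
  · simp [hItop']
  rw [← sub_eq_add_neg, ← EReal.neg_add (Or.inr (by simpa using hItop'))
    (Or.inl (by simpa using hItop)), ← ENNReal.log_mul_add, EReal.neg_le_neg_iff,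
    ENNReal.log_le_log_iff]
  refine ENNReal.le_mul_of_forall_lt (Or.inr hItop') (Or.inl hItop) fun a ha b hb => ?_
  simp only [gt_iff_lt, hI, hI', iInf_lt_iff, exists_prop] at ha hb
  obtain ⟨Q, hQ, hQa⟩ := ha
  obtain ⟨Q', hQ', hQb⟩ := hb
  have hQpos := (hM Q hQ.1).1
  have hΓnonneg : 0 ≤ trRe (Q * Γ) / trRe (Q * ρ) :=
    div_nonneg (Complex.nonneg_iff.mp (trace_mul_nonneg_of_posSemidef hQpos hΓ)).1
      (hη.le.trans hQ.2)
  have hmem : Q ⊗ₖ Q' ∈ {P | P ∈ M'' ∧ η * η' ≤ trRe (P * (ρ ⊗ₖ ρ'))} := by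
    refine ⟨hclose Q hQ.1 Q' hQ'.1, ?_⟩
    rw [trRe_kronecker_mul_kronecker hQpos hρ]
    exact mul_le_mul hQ.2 hQ'.2 hη'.le (hη.le.trans hQ.2)
  refine (iInf₂_le (Q ⊗ₖ Q') hmem).trans ?_
  rw [trRe_kronecker_mul_kronecker hQpos hρ, trRe_kronecker_mul_kronecker hQpos hΓ,
    mul_div_mul_comm, ENNReal.ofReal_mul hΓnonneg]
  exact mul_le_mul' hQa.le hQb.le

/-- Subadditivity for tensor-product states:
`D_{M''}^{ηη'}(ρ⊗ρ' ‖ Γ⊗Γ') ≥ D_M^η(ρ‖Γ) + D_{M'}^{η'}(ρ'‖Γ')` (in `EReal`, whose addition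
sends `⊥ + ⊤` to `⊥`, i.e. the sum is `−∞` if either summand is `−∞`); in particular
`H_{M''}^{ηη'}(ρ⊗ρ') ≤ H_M^η(ρ) + H_{M'}^{η'}(ρ')`. -/
theorem stmt6 {d d' : ℕ}
    (M : Set (Matrix (Fin d) (Fin d) ℂ)) (M' : Set (Matrix (Fin d') (Fin d') ℂ))
    (M'' : Set (Matrix (Fin d × Fin d') (Fin d × Fin d') ℂ))
    (hM : ∀ Q ∈ M, IsEffect Q) (hM' : ∀ Q ∈ M', IsEffect Q) (hM'' : ∀ Q ∈ M'', IsEffect Q)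
    (hclose : ∀ Q ∈ M, ∀ Q' ∈ M', Q ⊗ₖ Q' ∈ M'')
    (ρ Γ : Matrix (Fin d) (Fin d) ℂ) (ρ' Γ' : Matrix (Fin d') (Fin d') ℂ)
    (hρ : ρ.PosSemidef) (hρtr : trRe ρ ≤ 1) (hΓ : Γ.PosSemidef)
    (hρ' : ρ'.PosSemidef) (hρ'tr : trRe ρ' ≤ 1) (hΓ' : Γ'.PosSemidef)
    (η η' : ℝ) (hη : 0 < η) (hη2 : η ≤ trRe ρ) (hη' : 0 < η') (hη'2 : η' ≤ trRe ρ') :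
    Dc M ρ Γ η + Dc M' ρ' Γ' η' ≤ Dc M'' (ρ ⊗ₖ ρ') (Γ ⊗ₖ Γ') (η * η') ∧
    Hc M'' (ρ ⊗ₖ ρ') (η * η') ≤ Hc M ρ η + Hc M' ρ' η' := by
  refine ⟨Dc_add_le_Dc_kronecker hM hclose hρ hΓ hη hη', ?_⟩
  have hD := Dc_one_le_zero hM hρ hρtr hη
  have hD' := Dc_one_le_zero hM' hρ' hρ'tr hη'
  have h : Dc M ρ 1 η + Dc M' ρ' 1 η' ≤ Dc M'' (ρ ⊗ₖ ρ') 1 (η * η') := by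
    simpa using Dc_add_le_Dc_kronecker hM hclose hρ Matrix.PosSemidef.one hη hη' (Γ' := 1)
  unfold Hc
  rw [← sub_eq_add_neg, ← EReal.neg_add (Or.inr (hD'.trans_lt EReal.zero_lt_top).ne)
    (Or.inl (hD.trans_lt EReal.zero_lt_top).ne)]
  exact EReal.neg_le_neg_iff.mpr h

end
end

section
/- Let ρ_{AB} be a subnormalized quantum state and Γ_{AB} a positive-semidefinite matrix on ℂ^{d_A} ⊗ ℂ^{d_B}, and set ρ_A := tr_B(ρ_{AB}) and Γ_A := tr_B(Γ_{AB}). Let M_A be a set of POVM effects on ℂ^{d_A} and M_{AB} a set of POVM effects on ℂ^{d_A} ⊗ ℂ^{d_B} such that Q ⊗ I_B ∈ M_{AB} whenever Q ∈ M_A. Then for every η ∈ (0, tr ρ_{AB}]: D_{M_{AB}}^η(ρ_{AB}‖Γ_{AB}) ≥ D_{M_A}^η(ρ_A‖Γ_A). Consequently, H_{M_{AB}}^η(ρ_{AB}) ≤ H_{M_A}^η(ρ_A) + log(d_B). -/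
open Matrix
open scoped ComplexOrder Kronecker

noncomputable section

/-- Partial trace over the second tensor factor:
`(tr_B X)_{a,a'} = Σ_b X_{(a,b),(a',b)}`. -/
def ptraceSnd {dA dB : ℕ} (X : Matrix (Fin dA × Fin dB) (Fin dA × Fin dB) ℂ) :
    Matrix (Fin dA) (Fin dA) ℂ :=
  Matrix.of fun a a' => ∑ b : Fin dB, X (a, b) (a', b)

/-- Duality between tensoring with the identity and the partial trace. -/
theorem trace_kronecker_one_mul {dA dB : ℕ} (Q : Matrix (Fin dA) (Fin dA) ℂ)
    (X : Matrix (Fin dA × Fin dB) (Fin dA × Fin dB) ℂ) :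
    ((Q ⊗ₖ (1 : Matrix (Fin dB) (Fin dB) ℂ)) * X).trace = (Q * ptraceSnd X).trace := by
  simp only [Matrix.trace, Matrix.diag_apply, Matrix.mul_apply, ptraceSnd, Matrix.of_apply,
    Fintype.sum_prod_type, Matrix.kroneckerMap_apply, Matrix.one_apply, mul_ite, mul_one, mul_zero,
    ite_mul, zero_mul, Finset.sum_ite_eq, Finset.mem_univ, if_true, Finset.mul_sum]
  exact Finset.sum_congr rfl fun _ _ => Finset.sum_comm

theorem ptraceSnd_one {dA dB : ℕ} :
    ptraceSnd (1 : Matrix (Fin dA × Fin dB) (Fin dA × Fin dB) ℂ) =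
      (dB : ℝ) • (1 : Matrix (Fin dA) (Fin dA) ℂ) := by
  ext a a'
  by_cases h : a = a' <;> simp [ptraceSnd, Matrix.one_apply, h]

/-- The complexity relative entropy is monotone under partial traces. -/
theorem Dc_ptraceSnd_le {dA dB : ℕ} {MA : Set (Matrix (Fin dA) (Fin dA) ℂ)}
    {MAB : Set (Matrix (Fin dA × Fin dB) (Fin dA × Fin dB) ℂ)}
    (hclose : ∀ Q ∈ MA, Q ⊗ₖ (1 : Matrix (Fin dB) (Fin dB) ℂ) ∈ MAB)
    (ρ Γ : Matrix (Fin dA × Fin dB) (Fin dA × Fin dB) ℂ) (η : ℝ) :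
    Dc MA (ptraceSnd ρ) (ptraceSnd Γ) η ≤ Dc MAB ρ Γ η := by
  refine EReal.neg_le_neg_iff.mpr (ENNReal.log_monotone (le_iInf₂ fun Q hQ => ?_))
  have h (X : Matrix (Fin dA × Fin dB) (Fin dA × Fin dB) ℂ) :
      trRe ((Q ⊗ₖ (1 : Matrix (Fin dB) (Fin dB) ℂ)) * X) = trRe (Q * ptraceSnd X) :=
    congrArg Complex.re (trace_kronecker_one_mul Q X)
  exact (iInf₂_le _ ⟨hclose Q hQ.1, (h ρ).symm ▸ hQ.2⟩).trans_eq (by rw [h, h])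

/-- Rescaling the second argument shifts the complexity relative entropy by a logarithm. -/
theorem neg_Dc_smul {ι : Type*} [Fintype ι] [DecidableEq ι] (M : Set (Matrix ι ι ℂ))
    (ρ Γ : Matrix ι ι ℂ) (η : ℝ) {c : ℝ} (hc : 0 < c) :
    -Dc M ρ (c • Γ) η = -Dc M ρ Γ η + ((Real.log c : ℝ) : EReal) := by
  have h (Q : Matrix ι ι ℂ) : ENNReal.ofReal (trRe (Q * (c • Γ)) / trRe (Q * ρ)) =
      ENNReal.ofReal c * ENNReal.ofReal (trRe (Q * Γ) / trRe (Q * ρ)) := by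
    rw [← ENNReal.ofReal_mul hc.le, ← mul_div_assoc]
    simp [trRe]
  have hc₀ : ENNReal.ofReal c ≠ 0 := by simpa using hc
  simp only [Dc, neg_neg, h, ← ENNReal.mul_iInf_of_ne hc₀ ENNReal.ofReal_ne_top,
    ENNReal.log_mul_add, ENNReal.log_ofReal_of_pos hc]
  exact add_comm _ _

/-- Monotonicity of the complexity relative entropy under partial traces:
`D_{M_{AB}}^η(ρ_{AB}‖Γ_{AB}) ≥ D_{M_A}^η(ρ_A‖Γ_A)`; consequently
`H_{M_{AB}}^η(ρ_{AB}) ≤ H_{M_A}^η(ρ_A) + log d_B`. -/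
theorem stmt7 {dA dB : ℕ}
    (MA : Set (Matrix (Fin dA) (Fin dA) ℂ))
    (MAB : Set (Matrix (Fin dA × Fin dB) (Fin dA × Fin dB) ℂ))
    (hMA : ∀ Q ∈ MA, IsEffect Q) (hMAB : ∀ Q ∈ MAB, IsEffect Q)
    (hclose : ∀ Q ∈ MA, Q ⊗ₖ (1 : Matrix (Fin dB) (Fin dB) ℂ) ∈ MAB)
    (ρAB ΓAB : Matrix (Fin dA × Fin dB) (Fin dA × Fin dB) ℂ)
    (hρ : ρAB.PosSemidef) (hρtr : trRe ρAB ≤ 1) (hΓ : ΓAB.PosSemidef)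
    (η : ℝ) (hη : 0 < η) (hη' : η ≤ trRe ρAB) :
    Dc MA (ptraceSnd ρAB) (ptraceSnd ΓAB) η ≤ Dc MAB ρAB ΓAB η ∧
    Hc MAB ρAB η ≤ Hc MA (ptraceSnd ρAB) η + ((Real.log dB : ℝ) : EReal) := by
  refine ⟨Dc_ptraceSnd_le hclose ρAB ΓAB η, ?_⟩
  have hdB : (0 : ℝ) < dB := by
    rcases Nat.eq_zero_or_pos dB with rfl | h
    · simp [trRe, Matrix.trace] at hη'
      linarith
    · exact_mod_cast h
  rw [Hc, Hc, ← neg_Dc_smul MA _ _ η hdB, ← ptraceSnd_one]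
  exact EReal.neg_le_neg_iff.mpr (Dc_ptraceSnd_le hclose ρAB 1 η)

end
end

section
/- Let ρ_{ABC} be a subnormalized quantum state on ℂ^{d_A} ⊗ ℂ^{d_B} ⊗ ℂ^{d_C}, with marginals ρ_{AB} := tr_C(ρ_{ABC}), ρ_{BC} := tr_A(ρ_{ABC}), ρ_B := tr_{AC}(ρ_{ABC}). Let M_{AB} be a set of POVM effects on ℂ^{d_A} ⊗ ℂ^{d_B} and M_{ABC} a set of POVM effects on ℂ^{d_A} ⊗ ℂ^{d_B} ⊗ ℂ^{d_C} such that Q ⊗ I_C ∈ M_{ABC} whenever Q ∈ M_{AB}. Define the complexity conditional entropies H_{M_{ABC}}^η(A|BC)_ρ := −D_{M_{ABC}}^η(ρ_{ABC} ‖ I_A ⊗ ρ_{BC}) and H_{M_{AB}}^η(A|B)_ρ := −D_{M_{AB}}^η(ρ_{AB} ‖ I_A ⊗ ρ_B). Then for every η ∈ (0, tr ρ_{ABC}]: H_{M_{ABC}}^η(A|BC)_ρ ≤ H_{M_{AB}}^η(A|B)_ρ. -/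
open Matrix
open scoped ComplexOrder

noncomputable section

variable {dA dB dC : ℕ}

/-- Partial trace of `ρ_{ABC}` over `C`. -/
def trC (X : Matrix (Fin dA × Fin dB × Fin dC) (Fin dA × Fin dB × Fin dC) ℂ) :
    Matrix (Fin dA × Fin dB) (Fin dA × Fin dB) ℂ :=
  Matrix.of fun p p' => ∑ c : Fin dC, X (p.1, p.2, c) (p'.1, p'.2, c)

/-- Partial trace of `ρ_{ABC}` over `A`. -/
def trA (X : Matrix (Fin dA × Fin dB × Fin dC) (Fin dA × Fin dB × Fin dC) ℂ) :
    Matrix (Fin dB × Fin dC) (Fin dB × Fin dC) ℂ :=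
  Matrix.of fun q q' => ∑ a : Fin dA, X (a, q.1, q.2) (a, q'.1, q'.2)

/-- Partial trace of `ρ_{ABC}` over `A` and `C`. -/
def trAC (X : Matrix (Fin dA × Fin dB × Fin dC) (Fin dA × Fin dB × Fin dC) ℂ) :
    Matrix (Fin dB) (Fin dB) ℂ :=
  Matrix.of fun b b' => ∑ a : Fin dA, ∑ c : Fin dC, X (a, b, c) (a, b', c)

/-- `I_A ⊗ σ_{BC}` as a matrix on `A × B × C`. -/
def idAtensor (σ : Matrix (Fin dB × Fin dC) (Fin dB × Fin dC) ℂ) :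
    Matrix (Fin dA × Fin dB × Fin dC) (Fin dA × Fin dB × Fin dC) ℂ :=
  Matrix.of fun x y => (if x.1 = y.1 then 1 else 0) * σ (x.2.1, x.2.2) (y.2.1, y.2.2)

/-- `I_A ⊗ σ_B` as a matrix on `A × B`. -/
def idAtensorB (σ : Matrix (Fin dB) (Fin dB) ℂ) :
    Matrix (Fin dA × Fin dB) (Fin dA × Fin dB) ℂ :=
  Matrix.of fun x y => (if x.1 = y.1 then 1 else 0) * σ x.2 y.2

/-- `Q ⊗ I_C` as a matrix on `A × B × C`, for `Q` on `A × B`. -/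
def tensorIdC (Q : Matrix (Fin dA × Fin dB) (Fin dA × Fin dB) ℂ) :
    Matrix (Fin dA × Fin dB × Fin dC) (Fin dA × Fin dB × Fin dC) ℂ :=
  Matrix.of fun x y => Q (x.1, x.2.1) (y.1, y.2.1) * (if x.2.2 = y.2.2 then 1 else 0)

theorem trC_idAtensor_trA
    (ρ : Matrix (Fin dA × Fin dB × Fin dC) (Fin dA × Fin dB × Fin dC) ℂ) :
    trC (idAtensor (dA := dA) (trA ρ)) = idAtensorB (trAC ρ) := by
  ext x y
  simp only [trC, idAtensor, trA, idAtensorB, trAC, Matrix.of_apply]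
  rw [Finset.sum_comm, Finset.mul_sum]

theorem trace_tensorIdC_mul
    (Q : Matrix (Fin dA × Fin dB) (Fin dA × Fin dB) ℂ)
    (X : Matrix (Fin dA × Fin dB × Fin dC) (Fin dA × Fin dB × Fin dC) ℂ) :
    (tensorIdC Q * X).trace = (Q * trC X).trace := by
  simp only [Matrix.trace, Matrix.diag_apply, Matrix.mul_apply, tensorIdC, trC, Matrix.of_apply,
    Fintype.sum_prod_type, mul_ite, mul_one, mul_zero, ite_mul, zero_mul, Finset.sum_ite_eq,
    Finset.mem_univ, if_true, Finset.mul_sum]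
  refine Finset.sum_congr rfl fun a _ => Finset.sum_congr rfl fun b _ => ?_
  rw [Finset.sum_comm]
  exact Finset.sum_congr rfl fun a' _ => Finset.sum_comm

/-- Strong subadditivity of the complexity conditional entropy:
`H_{M_{ABC}}^η(A|BC)_ρ ≤ H_{M_{AB}}^η(A|B)_ρ`. -/
theorem stmt12
    (MAB : Set (Matrix (Fin dA × Fin dB) (Fin dA × Fin dB) ℂ))
    (MABC : Set (Matrix (Fin dA × Fin dB × Fin dC) (Fin dA × Fin dB × Fin dC) ℂ))
    (hMAB : ∀ Q ∈ MAB, IsEffect Q) (hMABC : ∀ Q ∈ MABC, IsEffect Q)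
    (hclose : ∀ Q ∈ MAB, tensorIdC Q ∈ MABC)
    (ρ : Matrix (Fin dA × Fin dB × Fin dC) (Fin dA × Fin dB × Fin dC) ℂ)
    (hρ : ρ.PosSemidef) (hρtr : trRe ρ ≤ 1)
    (η : ℝ) (hη : 0 < η) (hη' : η ≤ trRe ρ) :
    - Dc MABC ρ (idAtensor (trA ρ)) η ≤ - Dc MAB (trC ρ) (idAtensorB (trAC ρ)) η := by
  simp only [Dc, neg_neg]
  refine ENNReal.log_monotone (le_iInf₂ fun Q hQ => ?_)
  have htr (X : Matrix (Fin dA × Fin dB × Fin dC) (Fin dA × Fin dB × Fin dC) ℂ) :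
      trRe (tensorIdC Q * X) = trRe (Q * trC X) := by
    rw [trRe, trRe, trace_tensorIdC_mul]
  refine (iInf₂_le (tensorIdC Q) ⟨hclose Q hQ.1, (htr ρ).symm ▸ hQ.2⟩).trans_eq ?_
  rw [htr, htr, trC_idAtensor_trA]

end
end

section
/- Consider n qubits with Hilbert space (ℂ²)^{⊗n}. For each i ∈ {1,…,n} let Γ_i := diag(1, γ_i) with 0 < γ_i ≤ 1, and let Γ := Γ₁ ⊗ ⋯ ⊗ Γ_n. Let T be a set of linear maps on 2ⁿ×2ⁿ complex matrices such that every E ∈ T admits a Kraus representation E(X) = Σ_k A_k X A_k† with Σ_k A_k† A_k = I (so E is completely positive and trace-preserving) and satisfies E(Γ) = Γ; for such an E with a chosen Kraus family, its adjoint is E†(P) := Σ_k A_k† P A_k. For W ⊆ {1,…,n} let P_W be the POVM effect acting as the identity on each qubit in W and as |0⟩⟨0| on each qubit outside W. For an integer r ≥ 0 let M_r := { E₁†(E₂†(⋯E_m†(P_W)⋯)) : 0 ≤ m ≤ r, E₁,…,E_m ∈ T, W ⊆ {1,…,n} }. Let ρ be a quantum state and η ∈ (0,1]. Then min { Σ_{i∈W}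 log(tr Γ_i) : W ⊆ {1,…,n}, ∃ 0 ≤ m ≤ r and E₁,…,E_m ∈ T with tr( P_W · E_m(⋯E₁(ρ)⋯) ) ≥ η } = log( inf { tr(QΓ) : Q ∈ M_r, tr(Qρ) ≥ η } ); that is, the optimal work cost βW_r* of an erasure protocol consisting of at most r elementary computations from T followed by resets of the qubits in W equals −D_{h,M_r}^η(ρ‖Γ), the negative reduced complexity relative entropy. -/
open Matrix
open scoped ComplexOrder

noncomputable section

variable {n : ℕ}

/-- The single-qubit Gibbs-weight operator `Γ_i := diag(1, γ)`. -/
def gibbsOne (γ : ℝ) : Matrix (Fin 2) (Fin 2) ℂ :=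
  Matrix.diagonal (fun j => if j = 0 then 1 else (γ : ℂ))

/-- The `n`-qubit Gibbs-weight operator `Γ := Γ₁ ⊗ ⋯ ⊗ Γ_n`. -/
def gibbsAll (γ : Fin n → ℝ) : Matrix (Fin n → Fin 2) (Fin n → Fin 2) ℂ :=
  Matrix.of fun x y => ∏ i : Fin n, gibbsOne (γ i) (x i) (y i)

/-- The POVM effect acting as the identity on each qubit in `W` and as `|0⟩⟨0|` on each qubit
outside `W`. -/
def Pw (W : Finset (Fin n)) : Matrix (Fin n → Fin 2) (Fin n → Fin 2) ℂ :=
  Matrix.of fun x y => ∏ i : Fin n,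
    if i ∈ W then (if x i = y i then (1 : ℂ) else 0)
    else (if x i = 0 ∧ y i = 0 then 1 else 0)

/-- `E_m(⋯E₁(ρ)⋯)`: apply the first components of the listed pairs, in order, to `ρ`. -/
def applyFwd :
    List ((Matrix (Fin n → Fin 2) (Fin n → Fin 2) ℂ →ₗ[ℂ] Matrix (Fin n → Fin 2) (Fin n → Fin 2) ℂ)
        × (Matrix (Fin n → Fin 2) (Fin n → Fin 2) ℂ →ₗ[ℂ] Matrix (Fin n → Fin 2) (Fin n → Fin 2) ℂ))
    → Matrix (Fin n → Fin 2) (Fin n → Fin 2) ℂ → Matrix (Fin n → Fin 2) (Fin n → Fin 2) ℂ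
  | [], ρ => ρ
  | p :: rest, ρ => applyFwd rest (p.1 ρ)

/-- `E₁†(E₂†(⋯E_m†(P)⋯))`: apply the second components (the adjoints) of the listed pairs,
innermost last, to `P`. -/
def applyAdj :
    List ((Matrix (Fin n → Fin 2) (Fin n → Fin 2) ℂ →ₗ[ℂ] Matrix (Fin n → Fin 2) (Fin n → Fin 2) ℂ)
        × (Matrix (Fin n → Fin 2) (Fin n → Fin 2) ℂ →ₗ[ℂ] Matrix (Fin n → Fin 2) (Fin n → Fin 2) ℂ))
    → Matrix (Fin n → Fin 2) (Fin n → Fin 2) ℂ → Matrix (Fin n → Fin 2) (Fin n → Fin 2) ℂ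
  | [], P => P
  | p :: rest, P => p.2 (applyAdj rest P)

/-- `M_r`: all effects `E₁†(E₂†(⋯E_m†(P_W)⋯))` with `0 ≤ m ≤ r`, the `E_i` (with their chosen
adjoints) taken from `T`, and `W ⊆ {1,…,n}`. -/
def Mset14
    (T : Set ((Matrix (Fin n → Fin 2) (Fin n → Fin 2) ℂ →ₗ[ℂ] Matrix (Fin n → Fin 2) (Fin n → Fin 2) ℂ)
        × (Matrix (Fin n → Fin 2) (Fin n → Fin 2) ℂ →ₗ[ℂ] Matrix (Fin n → Fin 2) (Fin n → Fin 2) ℂ)))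
    (r : ℕ) : Set (Matrix (Fin n → Fin 2) (Fin n → Fin 2) ℂ) :=
  { Q | ∃ L, L.length ≤ r ∧ (∀ p ∈ L, p ∈ T) ∧
        ∃ W : Finset (Fin n), Q = applyAdj L (Pw W) }

/-- The adjoint sequence is dual to the forward sequence under the trace pairing. -/
theorem trace_applyAdj_mul
    (L : List ((Matrix (Fin n → Fin 2) (Fin n → Fin 2) ℂ →ₗ[ℂ] Matrix (Fin n → Fin 2) (Fin n → Fin 2) ℂ)
        × (Matrix (Fin n → Fin 2) (Fin n → Fin 2) ℂ →ₗ[ℂ] Matrix (Fin n → Fin 2) (Fin n → Fin 2) ℂ)))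
    (hL : ∀ p ∈ L, ∀ P X, (p.2 P * X).trace = (P * p.1 X).trace)
    (P X : Matrix (Fin n → Fin 2) (Fin n → Fin 2) ℂ) :
    (applyAdj L P * X).trace = (P * applyFwd L X).trace := by
  induction L generalizing X with
  | nil => rfl
  | cons p L ih =>
    rw [applyAdj, applyFwd, hL p (by simp), ih (fun q hq => hL q (by simp [hq]))]

theorem applyFwd_eq_self
    (L : List ((Matrix (Fin n → Fin 2) (Fin n → Fin 2) ℂ →ₗ[ℂ] Matrix (Fin n → Fin 2) (Fin n → Fin 2) ℂ)
        × (Matrix (Fin n → Fin 2) (Fin n → Fin 2) ℂ →ₗ[ℂ] Matrix (Fin n → Fin 2) (Fin n → Fin 2) ℂ)))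
    (X : Matrix (Fin n → Fin 2) (Fin n → Fin 2) ℂ) (hL : ∀ p ∈ L, p.1 X = X) :
    applyFwd L X = X := by
  induction L with
  | nil => rfl
  | cons p L ih => rw [applyFwd, hL p (by simp), ih (fun q hq => hL q (by simp [hq]))]

/-- A map in Kraus form and its adjoint are dual under the trace pairing. -/
theorem trace_sum_conjTranspose_mul_mul {ι κ : Type*} [Fintype ι] [Fintype κ]
    (A : κ → Matrix ι ι ℂ) (P X : Matrix ι ι ℂ) :
    ((∑ k, (A k)ᴴ * P * A k) * X).trace = (P * ∑ k, A k * X * (A k)ᴴ).trace := by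
  simp only [Finset.sum_mul, Finset.mul_sum, trace_sum]
  refine Finset.sum_congr rfl fun k _ => ?_
  rw [Matrix.mul_assoc, Matrix.mul_assoc, Matrix.trace_mul_comm]
  simp only [Matrix.mul_assoc]

/-- The trace of a product of two tensor-product operators factorizes. -/
theorem trace_of_prod_mul_of_prod {ι κ : Type*} [Fintype ι] [DecidableEq ι] [Fintype κ]
    (f g : ι → Matrix κ κ ℂ) :
    ((Matrix.of fun x y : ι → κ => ∏ i, f i (x i) (y i)) *
        Matrix.of fun x y : ι → κ => ∏ i, g i (x i) (y i)).trace =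
      ∏ i, (f i * g i).trace := by
  simp only [Matrix.trace, Matrix.diag_apply, Matrix.mul_apply, Matrix.of_apply,
    ← Finset.prod_mul_distrib, Fintype.prod_sum]

theorem trRe_gibbsOne (γ : ℝ) : trRe (gibbsOne γ) = 1 + γ := by
  simp [trRe, gibbsOne, Matrix.trace_diagonal, Fin.sum_univ_two]

theorem trRe_Pw_mul_gibbsAll (γ : Fin n → ℝ) (W : Finset (Fin n)) :
    trRe (Pw W * gibbsAll γ) = ∏ i ∈ W, trRe (gibbsOne (γ i)) := by
  have h : (Pw W * gibbsAll γ).trace = ∏ i, if i ∈ W then ((1 + γ i : ℝ) : ℂ) else 1 := by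
    have h' := trace_of_prod_mul_of_prod
      (fun i : Fin n => Matrix.of fun a b : Fin 2 =>
        if i ∈ W then (if a = b then (1 : ℂ) else 0) else (if a = 0 ∧ b = 0 then 1 else 0))
      (fun i => gibbsOne (γ i))
    refine h'.trans (Finset.prod_congr rfl fun i _ => ?_)
    by_cases hi : i ∈ W <;>
      simp [hi, Matrix.trace, Matrix.mul_apply, gibbsOne, Fin.sum_univ_two]
  rw [trRe, h, Finset.prod_ite_mem, Finset.univ_inter, ← Complex.ofReal_prod, Complex.ofReal_re]
  simp only [trRe_gibbsOne]

theorem Pw_univ : Pw (Finset.univ : Finset (Fin n)) = 1 := by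
  ext x y
  simp [Pw, Matrix.one_apply, Finset.prod_ite_zero, funext_iff]

/-- Optimal work cost of erasure for a product Hamiltonian: the minimum of
`Σ_{i∈W} log(tr Γ_i)` over feasible protocols (at most `r` Gibbs-preserving CPTP elementary
computations from `T` followed by resets of the qubits in `W`) equals
`log( inf { tr(QΓ) : Q ∈ M_r, tr(Qρ) ≥ η } ) = −D_{h,M_r}^η(ρ‖Γ)`. -/
theorem stmt14 (γ : Fin n → ℝ) (hγ : ∀ i, 0 < γ i ∧ γ i ≤ 1)
    (T : Set ((Matrix (Fin n → Fin 2) (Fin n → Fin 2) ℂ →ₗ[ℂ] Matrix (Fin n → Fin 2) (Fin n → Fin 2) ℂ)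
        × (Matrix (Fin n → Fin 2) (Fin n → Fin 2) ℂ →ₗ[ℂ] Matrix (Fin n → Fin 2) (Fin n → Fin 2) ℂ)))
    (hT : ∀ p ∈ T,
      (∃ m : ℕ, ∃ A : Fin m → Matrix (Fin n → Fin 2) (Fin n → Fin 2) ℂ,
        (∀ X, p.1 X = ∑ k, A k * X * (A k)ᴴ) ∧
        (∑ k, (A k)ᴴ * A k = 1) ∧
        (∀ P, p.2 P = ∑ k, (A k)ᴴ * P * A k)) ∧
      p.1 (gibbsAll γ) = gibbsAll γ)
    (ρ : Matrix (Fin n → Fin 2) (Fin n → Fin 2) ℂ)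
    (hρ : ρ.PosSemidef) (hρtr : ρ.trace = 1)
    (η : ℝ) (hη : η ∈ Set.Ioc (0:ℝ) 1) (r : ℕ) :
    sInf {w : ℝ | ∃ W : Finset (Fin n), ∃ L, L.length ≤ r ∧ (∀ p ∈ L, p ∈ T) ∧
        η ≤ trRe (Pw W * applyFwd L ρ) ∧
        w = ∑ i ∈ W, Real.log (trRe (gibbsOne (γ i)))} =
      Real.log (sInf {x : ℝ | ∃ Q ∈ Mset14 T r,
        η ≤ trRe (Q * ρ) ∧ x = trRe (Q * gibbsAll γ)}) := by
  have hdual : ∀ L, (∀ p ∈ L, p ∈ T) → ∀ W X,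
      trRe (applyAdj L (Pw W) * X) = trRe (Pw W * applyFwd L X) := fun L hL W X => by
    refine congrArg Complex.re (trace_applyAdj_mul L (fun p hp P Y => ?_) (Pw W) X)
    obtain ⟨⟨m, A, h1, -, h2⟩, -⟩ := hT p (hL p hp)
    rw [h1, h2, trace_sum_conjTranspose_mul_mul]
  have hcost : ∀ L, (∀ p ∈ L, p ∈ T) → ∀ W,
      trRe (applyAdj L (Pw W) * gibbsAll γ) =
        Real.exp (∑ i ∈ W, Real.log (trRe (gibbsOne (γ i)))) := fun L hL W => by
    rw [hdual L hL, applyFwd_eq_self L _ fun p hp => (hT p (hL p hp)).2, trRe_Pw_mul_gibbsAll,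
      Real.exp_sum]
    refine Finset.prod_congr rfl fun i _ => (Real.exp_log ?_).symm
    rw [trRe_gibbsOne]
    linarith [(hγ i).1]
  set S := {w : ℝ | ∃ W : Finset (Fin n), ∃ L, L.length ≤ r ∧ (∀ p ∈ L, p ∈ T) ∧
        η ≤ trRe (Pw W * applyFwd L ρ) ∧
        w = ∑ i ∈ W, Real.log (trRe (gibbsOne (γ i)))}
  have himage : {x : ℝ | ∃ Q ∈ Mset14 T r, η ≤ trRe (Q * ρ) ∧ x = trRe (Q * gibbsAll γ)} =
      Real.exp '' S := by
    ext x
    constructor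
    · rintro ⟨_, ⟨L, hr, hL, W, rfl⟩, hρη, rfl⟩
      exact ⟨_, ⟨W, L, hr, hL, hdual L hL W ρ ▸ hρη, rfl⟩, (hcost L hL W).symm⟩
    · rintro ⟨_, ⟨W, L, hr, hL, hρη, rfl⟩, rfl⟩
      exact ⟨_, ⟨L, hr, hL, W, rfl⟩, (hdual L hL W ρ).symm ▸ hρη, (hcost L hL W).symm⟩
  have hfin : S.Finite := by
    refine (Set.finite_range fun W : Finset (Fin n) =>
      ∑ i ∈ W, Real.log (trRe (gibbsOne (γ i)))).subset ?_
    rintro _ ⟨W, -, -, -, -, rfl⟩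
    exact ⟨W, rfl⟩
  have hne : S.Nonempty :=
    ⟨_, Finset.univ, [], by simp, by simp, by simp [Pw_univ, applyFwd, trRe, hρtr, hη.2], rfl⟩
  have hleast : IsLeast S (sInf S) := ⟨hne.csInf_mem hfin, fun _ => csInf_le hfin.bddBelow⟩
  rw [himage, (Real.exp_monotone.map_isLeast hleast).csInf_eq, Real.log_exp]

end
end

section
/- Let n ≥ 2 and let ρ be a quantum state on the n-qubit Hilbert space (ℂ²)^{⊗n}, with qubits labeled S₁,…,S_n in order. Let 1 ≤ k ≤ n−1 and let U = I_{2^{k−1}} ⊗ u ⊗ I_{2^{n−k−1}} for some 4×4 unitary u on ℂ² ⊗ ℂ² (so U acts nontrivially only on the neighboring qubits k and k+1). Then |E(UρU†) − E(ρ)| ≤ 8·log(2)/(n−1), where E(ρ) := (1/(n−1)) Σ_{j=1}^{n−1} I(S₁…S_j : S_{j+1}…S_n)_ρ. -/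
open Matrix
open scoped ComplexOrder

noncomputable section

/-- Von Neumann entropy `H(σ) := −Σ_j λ_j log λ_j` of a (Hermitian) matrix, via its
eigenvalues; junk value `0` for non-Hermitian matrices. The convention `0·log 0 = 0` is
automatic since `Real.log 0 = 0`. -/
def vN {m : Type*} [Fintype m] [DecidableEq m] (σ : Matrix m m ℂ) : ℝ :=
  if h : σ.IsHermitian then -∑ i, h.eigenvalues i * Real.log (h.eigenvalues i) else 0

variable {n : ℕ}

/-- The reduced state of `ρ` on the qubits in `S` (partial trace over the qubits outside `S`). -/
def red (S : Finset (Fin n)) (ρ : Matrix (Fin n → Fin 2) (Fin n → Fin 2) ℂ) :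
    Matrix ({i // i ∈ S} → Fin 2) ({i // i ∈ S} → Fin 2) ℂ :=
  Matrix.of fun a a' => ∑ z : Fin n → Fin 2,
    if (fun i : {i // i ∈ S} => z i.1) = a
    then ρ z (fun j => if h : j ∈ S then a' ⟨j, h⟩ else z j) else 0

/-- The quantum mutual information `I(S₁…S_j : S_{j+1}…S_n)_ρ` across the cut after qubit `j`
(qubits `0,…,j−1` versus qubits `j,…,n−1` in 0-indexed terms). -/
def mutInfo (j : ℕ) (ρ : Matrix (Fin n → Fin 2) (Fin n → Fin 2) ℂ) : ℝ :=
  vN (red (Finset.univ.filter fun i : Fin n => (i : ℕ) < j) ρ) +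
  vN (red (Finset.univ.filter fun i : Fin n => j ≤ (i : ℕ)) ρ) - vN ρ

/-- The entanglement measure `E(ρ) := (1/(n−1)) Σ_{j=1}^{n−1} I(S₁…S_j : S_{j+1}…S_n)_ρ`. -/
def Emeas (ρ : Matrix (Fin n → Fin 2) (Fin n → Fin 2) ℂ) : ℝ :=
  (1 / ((n : ℝ) - 1)) * ∑ j ∈ Finset.Icc 1 (n - 1), mutInfo j ρ

/-- The unitary `u` acting on the two qubits `p` and `q`, tensored with the identity on all
other qubits. -/
def embed2 (p q : Fin n) (u : Matrix (Fin 2 × Fin 2) (Fin 2 × Fin 2) ℂ) :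
    Matrix (Fin n → Fin 2) (Fin n → Fin 2) ℂ :=
  Matrix.of fun x y =>
    u (x p, x q) (y p, y q) *
      ∏ i : Fin n, if i = p ∨ i = q then 1 else (if x i = y i then 1 else 0)

section Entropy

variable {m l : Type*} [Fintype m] [DecidableEq m] [Fintype l] [DecidableEq l]

lemma vN_eq_sum_negMulLog {M : Matrix m m ℂ} (h : M.IsHermitian) :
    vN M = ∑ i, Real.negMulLog (h.eigenvalues i) := by
  simp [vN, h, Real.negMulLog]

lemma vN_eq_sum_roots {M : Matrix m m ℂ} (h : M.IsHermitian) :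
    vN M = (M.charpoly.roots.map fun z => Real.negMulLog z.re).sum := by
  rw [vN_eq_sum_negMulLog h, h.roots_charpoly_eq_eigenvalues, Multiset.map_map]
  simp [Function.comp_def]

lemma vN_eq_of_charpoly_eq {M : Matrix m m ℂ} {N : Matrix l l ℂ} (hM : M.IsHermitian)
    (hN : N.IsHermitian) (h : M.charpoly = N.charpoly) : vN M = vN N := by
  rw [vN_eq_sum_roots hM, vN_eq_sum_roots hN, h]

lemma vN_submatrix_equiv {M : Matrix m m ℂ} (hM : M.IsHermitian) (e : l ≃ m) :
    vN (M.submatrix e e) = vN M :=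
  vN_eq_of_charpoly_eq (hM.submatrix e) hM (charpoly_reindex e.symm M)

lemma vN_unitary_conj {M V : Matrix m m ℂ} (hM : M.IsHermitian)
    (hV : V ∈ unitaryGroup m ℂ) : vN (V * M * Vᴴ) = vN M := by
  refine vN_eq_of_charpoly_eq (isHermitian_mul_mul_conjTranspose V hM) hM ?_
  rw [charpoly_mul_comm, ← mul_assoc, ← star_eq_conjTranspose, mem_unitaryGroup_iff'.mp hV, one_mul]

lemma vN_mul_conjTranspose_comm (X : Matrix m l ℂ) : vN (X * Xᴴ) = vN (Xᴴ * X) := by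
  have h := congrArg (fun p => (p.roots.map fun z : ℂ => Real.negMulLog z.re).sum)
    (charpoly_mul_comm' X Xᴴ)
  have hne (A : Matrix m m ℂ) (k : ℕ) : Polynomial.X ^ k * A.charpoly ≠ 0 :=
    mul_ne_zero (pow_ne_zero _ Polynomial.X_ne_zero) (charpoly_monic A).ne_zero
  have hne' (A : Matrix l l ℂ) (k : ℕ) : Polynomial.X ^ k * A.charpoly ≠ 0 :=
    mul_ne_zero (pow_ne_zero _ Polynomial.X_ne_zero) (charpoly_monic A).ne_zero
  simp only [Polynomial.roots_mul (hne _ _), Polynomial.roots_mul (hne' _ _),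
    Polynomial.roots_X_pow, Multiset.map_add, Multiset.sum_add] at h
  rw [vN_eq_sum_roots (isHermitian_mul_conjTranspose_self X),
    vN_eq_sum_roots (isHermitian_conjTranspose_mul_self X)]
  simpa [Multiset.map_nsmul, Multiset.sum_nsmul] using h

/-- The Peierls inequality: the entropy is at most the Shannon entropy of the diagonal in any
orthonormal basis. -/
lemma vN_le_sum_negMulLog_diag {M : Matrix m m ℂ} (hM : M.PosSemidef) {U : Matrix m m ℂ}
    (hU : U ∈ unitaryGroup m ℂ) :
    vN M ≤ ∑ i, Real.negMulLog ((Uᴴ * M * U) i i).re := by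
  set W : Matrix m m ℂ := hM.1.eigenvectorUnitary.1 with hW
  have hWU : W ∈ unitaryGroup m ℂ := hM.1.eigenvectorUnitary.2
  set Q := Uᴴ * W with hQ
  have hQU : Q ∈ unitaryGroup m ℂ := mul_mem (Unitary.star_mem hU) hWU
  have hrow (i : m) : ∑ j, Complex.normSq (Q i j) = 1 := by
    have := congrFun (congrFun (mem_unitaryGroup_iff.mp hQU) i) i
    rw [mul_apply] at this
    simp only [star_apply, RCLike.star_def, Complex.mul_conj, one_apply_eq] at this
    exact_mod_cast this
  have hcol (j : m) : ∑ i, Complex.normSq (Q i j) = 1 := by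
    have := congrFun (congrFun (mem_unitaryGroup_iff'.mp hQU) j) j
    rw [mul_apply] at this
    simp only [star_apply, RCLike.star_def, mul_comm, Complex.mul_conj, one_apply_eq] at this
    exact_mod_cast this
  have hdiag (i : m) : ((Uᴴ * M * U) i i).re =
      ∑ j, Complex.normSq (Q i j) * hM.1.eigenvalues j := by
    have hMe : Uᴴ * M * U = Q * diagonal (RCLike.ofReal ∘ hM.1.eigenvalues) * Qᴴ := by
      conv_lhs => rw [hM.1.spectral_theorem]
      simp [hQ, hW, Unitary.conjStarAlgAut_apply, mul_assoc, star_eq_conjTranspose]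
    rw [hMe, mul_apply, Complex.re_sum]
    refine Finset.sum_congr rfl fun j _ => ?_
    rw [mul_diagonal, conjTranspose_apply, mul_right_comm,
      show star (Q i j) = starRingEnd ℂ (Q i j) from rfl, Complex.mul_conj]
    simp
  have hJ (i : m) : ∑ j, Complex.normSq (Q i j) * Real.negMulLog (hM.1.eigenvalues j) ≤
      Real.negMulLog ((Uᴴ * M * U) i i).re := by
    rw [hdiag]
    have := Real.concaveOn_negMulLog.le_map_sum (t := Finset.univ)
      (w := fun j => Complex.normSq (Q i j)) (p := hM.1.eigenvalues)
      (fun j _ => Complex.normSq_nonneg _) (hrow i) (fun j _ => hM.eigenvalues_nonneg j)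
    simpa only [smul_eq_mul] using this
  calc vN M = ∑ j, (∑ i, Complex.normSq (Q i j)) * Real.negMulLog (hM.1.eigenvalues j) := by
        simp only [hcol, one_mul, vN_eq_sum_negMulLog hM.1]
    _ = ∑ i, ∑ j, Complex.normSq (Q i j) * Real.negMulLog (hM.1.eigenvalues j) := by
        simp only [Finset.sum_mul]; exact Finset.sum_comm
    _ ≤ _ := Finset.sum_le_sum fun i _ => hJ i

lemma eigenvectorUnitary_conj_apply {M : Matrix m m ℂ} (hM : M.IsHermitian) (i : m) :
    ((hM.eigenvectorUnitary : Matrix m m ℂ)ᴴ * M * hM.eigenvectorUnitary) i i =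
      hM.eigenvalues i := by
  have h := hM.conjStarAlgAut_star_eigenvectorUnitary
  rw [Unitary.conjStarAlgAut_star_apply] at h
  rw [← star_eq_conjTranspose, h]
  simp

lemma negMulLog_add_le {a c : ℝ} (ha : 0 ≤ a) (hc : 0 ≤ c) :
    Real.negMulLog a + Real.negMulLog c ≤ Real.negMulLog (a + c) + (a + c) * Real.log 2 := by
  have h := Real.concaveOn_negMulLog.2 ha hc (show (0 : ℝ) ≤ 1 / 2 by norm_num)
    (show (0 : ℝ) ≤ 1 / 2 by norm_num) (by norm_num)
  simp only [smul_eq_mul] at h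
  rw [← mul_add (1 / 2 : ℝ) a c, ← mul_add, Real.negMulLog_mul] at h
  have h2 : Real.negMulLog (1 / 2) = 1 / 2 * Real.log 2 := by
    simp [Real.negMulLog]
  rw [h2] at h
  linarith

lemma vN_add_vN_le {A C : Matrix m m ℂ} (hA : A.PosSemidef) (hC : C.PosSemidef) :
    vN A + vN C ≤ vN (A + C) + (A + C).trace.re * Real.log 2 := by
  have hAC := hA.add hC
  set W : Matrix m m ℂ := hAC.1.eigenvectorUnitary.1 with hW
  have hWU : W ∈ unitaryGroup m ℂ := hAC.1.eigenvectorUnitary.2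
  have hsum (i : m) : ((Wᴴ * A * W) i i).re + ((Wᴴ * C * W) i i).re = hAC.1.eigenvalues i := by
    have h := eigenvectorUnitary_conj_apply hAC.1 i
    rw [mul_add, add_mul, Matrix.add_apply] at h
    simpa using congrArg Complex.re h
  have hnn {B : Matrix m m ℂ} (hB : B.PosSemidef) (i : m) : 0 ≤ ((Wᴴ * B * W) i i).re :=
    (Complex.le_def.mp (hB.conjTranspose_mul_mul_same W).diag_nonneg).1
  calc vN A + vN C ≤ _ :=
        add_le_add (vN_le_sum_negMulLog_diag hA hWU) (vN_le_sum_negMulLog_diag hC hWU)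
    _ ≤ ∑ i, (Real.negMulLog (hAC.1.eigenvalues i) + hAC.1.eigenvalues i * Real.log 2) := by
        rw [← Finset.sum_add_distrib]
        refine Finset.sum_le_sum fun i _ => ?_
        rw [← hsum i]
        exact negMulLog_add_le (hnn hA i) (hnn hC i)
    _ = _ := by
        rw [Finset.sum_add_distrib, ← Finset.sum_mul, vN_eq_sum_negMulLog hAC.1,
          hAC.1.trace_eq_sum_eigenvalues]
        simp

/-- Pinching does not decrease the entropy. -/
lemma vN_fromBlocks_le {A : Matrix m m ℂ} {B : Matrix m l ℂ} {B' : Matrix l m ℂ}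
    {C : Matrix l l ℂ} (hM : (fromBlocks A B B' C).PosSemidef) :
    vN (fromBlocks A B B' C) ≤ vN A + vN C := by
  have hA : A.IsHermitian := (hM.submatrix Sum.inl).1
  have hC : C.IsHermitian := (hM.submatrix Sum.inr).1
  set U : Matrix (m ⊕ l) (m ⊕ l) ℂ :=
    fromBlocks hA.eigenvectorUnitary.1 0 0 hC.eigenvectorUnitary.1 with hUdef
  have hU : U ∈ unitaryGroup (m ⊕ l) ℂ := by
    rw [mem_unitaryGroup_iff, star_eq_conjTranspose, hUdef, fromBlocks_conjTranspose,
      fromBlocks_multiply]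
    simp [← star_eq_conjTranspose]
  refine (vN_le_sum_negMulLog_diag hM hU).trans_eq ?_
  rw [hUdef, fromBlocks_conjTranspose, fromBlocks_multiply, fromBlocks_multiply,
    Fintype.sum_sum_type, vN_eq_sum_negMulLog hA, vN_eq_sum_negMulLog hC]
  simp [eigenvectorUnitary_conj_apply]

open scoped MatrixOrder in
lemma _root_.Matrix.PosSemidef.exists_eq_conjTranspose_mul_self {A : Matrix m m ℂ}
    (hA : A.PosSemidef) : ∃ Y : Matrix m m ℂ, A = Yᴴ * Y :=
  CStarAlgebra.nonneg_iff_eq_star_mul_self.mp hA.nonneg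

lemma vN_add_le {A C : Matrix m m ℂ} (hA : A.PosSemidef) (hC : C.PosSemidef) :
    vN (A + C) ≤ vN A + vN C := by
  obtain ⟨X, rfl⟩ : ∃ X : Matrix m m ℂ, A = X * Xᴴ := by
    obtain ⟨X, hX⟩ := hA.exists_eq_conjTranspose_mul_self
    exact ⟨Xᴴ, by simpa using hX⟩
  obtain ⟨Z, rfl⟩ : ∃ Z : Matrix m m ℂ, C = Z * Zᴴ := by
    obtain ⟨Z, hZ⟩ := hC.exists_eq_conjTranspose_mul_self
    exact ⟨Zᴴ, by simpa using hZ⟩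
  have h1 : X * Xᴴ + Z * Zᴴ = fromCols X Z * (fromCols X Z)ᴴ := by
    rw [conjTranspose_fromCols_eq_fromRows_conjTranspose, fromCols_mul_fromRows]
  have h2 : (fromCols X Z)ᴴ * fromCols X Z =
      fromBlocks (Xᴴ * X) (Xᴴ * Z) (Zᴴ * X) (Zᴴ * Z) := by
    rw [conjTranspose_fromCols_eq_fromRows_conjTranspose, fromRows_mul_fromCols]
  rw [h1, vN_mul_conjTranspose_comm, h2, vN_mul_conjTranspose_comm X,
    vN_mul_conjTranspose_comm Z]
  exact vN_fromBlocks_le (h2 ▸ posSemidef_conjTranspose_mul_self _)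

/-- Tracing out a qubit changes the entropy by at most `log 2` per unit of trace. -/
lemma abs_vN_fromBlocks_sub_le {A B B' C : Matrix m m ℂ} (hM : (fromBlocks A B B' C).PosSemidef) :
    |vN (fromBlocks A B B' C) - vN (A + C)| ≤ (A + C).trace.re * Real.log 2 := by
  have hA : A.PosSemidef := hM.submatrix Sum.inl
  have hC : C.PosSemidef := hM.submatrix Sum.inr
  have hupper := (vN_fromBlocks_le hM).trans (vN_add_vN_le hA hC)
  obtain ⟨Y, hY⟩ := hM.exists_eq_conjTranspose_mul_self
  obtain ⟨X, Z, rfl⟩ : ∃ X Z, Y = fromCols X Z := ⟨_, _, (fromCols_toCols Y).symm⟩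
  have hY' := hY
  rw [conjTranspose_fromCols_eq_fromRows_conjTranspose, fromRows_mul_fromCols,
    fromBlocks_inj] at hY'
  obtain ⟨rfl, -, -, rfl⟩ := hY'
  have hlower := vN_add_vN_le (posSemidef_self_mul_conjTranspose X)
    (posSemidef_self_mul_conjTranspose Z)
  rw [vN_mul_conjTranspose_comm X, vN_mul_conjTranspose_comm Z, trace_add,
    trace_mul_comm X, trace_mul_comm Z, ← trace_add, ← fromCols_mul_fromRows,
    ← conjTranspose_fromCols_eq_fromRows_conjTranspose, vN_mul_conjTranspose_comm, ← hY] at hlower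
  have hsub := vN_add_le hA hC
  rw [abs_le]
  constructor <;> linarith

end Entropy

section PartialTrace

open scoped Kronecker

variable {α β : Type*} [Fintype β]

/-- The partial trace over the second tensor factor. -/
def ptrace (M : Matrix (α × β) (α × β) ℂ) : Matrix α α ℂ :=
  Matrix.of fun a a' => ∑ c, M (a, c) (a', c)

lemma ptrace_eq_sum_submatrix (M : Matrix (α × β) (α × β) ℂ) :
    ptrace M = ∑ c, M.submatrix (fun a => (a, c)) (fun a => (a, c)) := by
  ext a a'
  simp [ptrace, Matrix.sum_apply]

variable [Fintype α] [DecidableEq β]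

lemma ptrace_kronecker_one_conj (V : Matrix α α ℂ) (M : Matrix (α × β) (α × β) ℂ) :
    ptrace ((V ⊗ₖ (1 : Matrix β β ℂ)) * M * (V ⊗ₖ (1 : Matrix β β ℂ))ᴴ) =
      V * ptrace M * Vᴴ := by
  simp only [ptrace_eq_sum_submatrix, Finset.mul_sum, Finset.sum_mul]
  refine Finset.sum_congr rfl fun c _ => ?_
  ext a a'
  simp [mul_apply, Fintype.sum_prod_type, one_apply, apply_ite]

variable [DecidableEq α]

lemma ptrace_one_kronecker_conj {W : Matrix β β ℂ} (hW : W ∈ unitaryGroup β ℂ)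
    (M : Matrix (α × β) (α × β) ℂ) :
    ptrace (((1 : Matrix α α ℂ) ⊗ₖ W) * M * ((1 : Matrix α α ℂ) ⊗ₖ W)ᴴ) = ptrace M := by
  ext a a'
  have h : (((1 : Matrix α α ℂ) ⊗ₖ W) * M * ((1 : Matrix α α ℂ) ⊗ₖ W)ᴴ).submatrix
      (fun c => (a, c)) (fun c => (a', c)) =
      W * M.submatrix (fun c => (a, c)) (fun c => (a', c)) * Wᴴ := by
    ext c c'
    simp [mul_apply, Fintype.sum_prod_type, one_apply, apply_ite]
  have htr := congrArg trace h
  rw [trace_mul_comm, ← mul_assoc, ← star_eq_conjTranspose W, mem_unitaryGroup_iff'.mp hW,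
    one_mul] at htr
  exact htr

lemma mem_unitaryGroup_of_kronecker_one [Nonempty β] {V : Matrix α α ℂ}
    (h : V ⊗ₖ (1 : Matrix β β ℂ) ∈ unitaryGroup (α × β) ℂ) : V ∈ unitaryGroup α ℂ := by
  obtain ⟨c⟩ := ‹Nonempty β›
  rw [mem_unitaryGroup_iff, star_eq_conjTranspose, conjTranspose_kronecker,
    ← mul_kronecker_mul] at h
  rw [mem_unitaryGroup_iff, star_eq_conjTranspose]
  ext a a'
  simpa [one_apply] using congrFun (congrFun h (a, c)) (a', c)

lemma mem_unitaryGroup_of_one_kronecker [Nonempty α] {W : Matrix β β ℂ}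
    (h : (1 : Matrix α α ℂ) ⊗ₖ W ∈ unitaryGroup (α × β) ℂ) : W ∈ unitaryGroup β ℂ := by
  obtain ⟨a⟩ := ‹Nonempty α›
  rw [mem_unitaryGroup_iff, star_eq_conjTranspose, conjTranspose_kronecker,
    ← mul_kronecker_mul] at h
  rw [mem_unitaryGroup_iff, star_eq_conjTranspose]
  ext c c'
  simpa [one_apply] using congrFun (congrFun h (a, c)) (a, c')

lemma submatrix_mem_unitaryGroup {U : Matrix α α ℂ} (hU : U ∈ unitaryGroup α ℂ) (e : β ≃ α) :
    U.submatrix e e ∈ unitaryGroup β ℂ := by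
  rw [mem_unitaryGroup_iff, star_eq_conjTranspose, conjTranspose_submatrix,
    submatrix_mul_equiv, ← star_eq_conjTranspose, mem_unitaryGroup_iff.mp hU,
    submatrix_one_equiv]

end PartialTrace

section Qubits

open scoped Kronecker

/-- Configurations of all qubits from configurations inside and outside `S`. -/
def glue (S : Finset (Fin n)) :
    ({i // i ∈ S} → Fin 2) × ({i // i ∉ S} → Fin 2) ≃ (Fin n → Fin 2) :=
  (Equiv.piEquivPiSubtypeProd (· ∈ S) fun _ => Fin 2).symm

lemma glue_apply (S : Finset (Fin n)) (a : {i // i ∈ S} → Fin 2) (c : {i // i ∉ S} → Fin 2)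
    (j : Fin n) : glue S (a, c) j = if h : j ∈ S then a ⟨j, h⟩ else c ⟨j, h⟩ := rfl

variable (S : Finset (Fin n)) (ρ : Matrix (Fin n → Fin 2) (Fin n → Fin 2) ℂ)

lemma red_eq_ptrace : red S ρ = ptrace (ρ.submatrix (glue S) (glue S)) := by
  ext a a'
  have h1 (b : {i // i ∈ S} → Fin 2) (c : {i // i ∉ S} → Fin 2) :
      (fun i : {i // i ∈ S} => glue S (b, c) i.1) = b := by
    ext i; simp [glue_apply]
  have h2 (b : {i // i ∈ S} → Fin 2) (c : {i // i ∉ S} → Fin 2) :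
      (fun j => if h : j ∈ S then a' ⟨j, h⟩ else glue S (b, c) j) = glue S (a', c) := by
    ext j; by_cases hj : j ∈ S <;> simp [glue_apply, hj]
  simp only [red, ptrace, of_apply, submatrix_apply]
  rw [← (glue S).sum_comp, Fintype.sum_prod_type]
  simp [h1, h2]

variable {ρ}

lemma red_posSemidef (hρ : ρ.PosSemidef) : (red S ρ).PosSemidef := by
  rw [red_eq_ptrace, ptrace_eq_sum_submatrix]
  exact posSemidef_sum _ fun c _ => (hρ.submatrix _).submatrix _

variable (ρ) in
lemma trace_red : (red S ρ).trace = ρ.trace := by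
  rw [red_eq_ptrace]
  simp only [trace, ptrace, diag_apply, of_apply, submatrix_apply]
  rw [← (glue S).sum_comp, Fintype.sum_prod_type]

variable {S}
variable {p q : Fin n} (u : Matrix (Fin 2 × Fin 2) (Fin 2 × Fin 2) ℂ)

lemma embed2_apply (x y : Fin n → Fin 2) :
    embed2 p q u x y =
      u (x p, x q) (y p, y q) * if ∀ i, i ≠ p ∧ i ≠ q → x i = y i then 1 else 0 := by
  rw [embed2, of_apply]
  congr 1
  split_ifs with h
  · refine Finset.prod_eq_one fun i _ => ?_
    by_cases hi : i = p ∨ i = q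
    · simp [hi]
    · simp [hi, h i (not_or.mp hi)]
  · push Not at h
    obtain ⟨i, ⟨hp, hq⟩, hi⟩ := h
    exact Finset.prod_eq_zero (Finset.mem_univ i) (by simp [hp, hq, hi])

lemma bijective_split (hpq : p ≠ q) :
    Function.Bijective fun x : Fin n → Fin 2 =>
      (((x p, x q), fun i => x i.1) : (Fin 2 × Fin 2) × ({i // i ≠ p ∧ i ≠ q} → Fin 2)) := by
  constructor
  · intro x y h
    simp only [Prod.mk.injEq] at h
    ext i
    by_cases hp : i = p
    · rw [hp, h.1.1]
    by_cases hq : i = q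
    · rw [hq, h.1.2]
    exact congrArg _ (congrFun h.2 ⟨i, hp, hq⟩)
  · rintro ⟨⟨a, b⟩, c⟩
    refine ⟨fun i => if hp : i = p then a else if hq : i = q then b else c ⟨i, hp, hq⟩, ?_⟩
    simp only [Prod.mk.injEq]
    refine ⟨⟨by simp, by simp [hpq.symm]⟩, ?_⟩
    ext i
    simp [i.2.1, i.2.2]

variable {u}

lemma embed2_mem_unitaryGroup (hpq : p ≠ q) (hu : u ∈ unitaryGroup (Fin 2 × Fin 2) ℂ) :
    embed2 p q u ∈ unitaryGroup (Fin n → Fin 2) ℂ := by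
  have h : embed2 p q u = (u ⊗ₖ (1 : Matrix ({i // i ≠ p ∧ i ≠ q} → Fin 2) _ ℂ)).submatrix
      (Equiv.ofBijective _ (bijective_split hpq)) (Equiv.ofBijective _ (bijective_split hpq)) := by
    ext x y
    simp [embed2_apply, one_apply, funext_iff]
  rw [h]
  exact submatrix_mem_unitaryGroup (kronecker_mem_unitary hu (one_mem _)) _

lemma embed2_submatrix_glue_of_mem (hp : p ∈ S) (hq : q ∈ S) :
    (embed2 p q u).submatrix (glue S) (glue S) =
      ((embed2 p q u).submatrix (fun a => glue S (a, 0)) fun a => glue S (a, 0)) ⊗ₖ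
        (1 : Matrix ({i // i ∉ S} → Fin 2) _ ℂ) := by
  ext ⟨a, c⟩ ⟨a', c'⟩
  have h : (∀ i, i ≠ p ∧ i ≠ q → glue S (a, c) i = glue S (a', c') i) ↔
      (∀ i, i ≠ p ∧ i ≠ q → glue S (a, 0) i = glue S (a', 0) i) ∧ c = c' := by
    refine ⟨fun h => ⟨fun i hi => ?_, ?_⟩, fun ⟨h, hc⟩ i hi => ?_⟩
    · have := h i hi
      by_cases hS : i ∈ S <;> simp_all [glue_apply]
    · ext i
      have := h i ⟨fun e => i.2 (e ▸ hp), fun e => i.2 (e ▸ hq)⟩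
      simpa [glue_apply, i.2] using congrArg Fin.val this
    · have := h i hi
      by_cases hS : i ∈ S <;> simp_all [glue_apply]
  simp only [submatrix_apply, kroneckerMap_apply, embed2_apply, h, one_apply, ite_and]
  split_ifs <;> simp [glue_apply, hp, hq]

lemma embed2_submatrix_glue_of_notMem (hp : p ∉ S) (hq : q ∉ S) :
    (embed2 p q u).submatrix (glue S) (glue S) =
      (1 : Matrix ({i // i ∈ S} → Fin 2) _ ℂ) ⊗ₖ
        ((embed2 p q u).submatrix (fun c => glue S (0, c)) fun c => glue S (0, c)) := by
  ext ⟨a, c⟩ ⟨a', c'⟩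
  have h : (∀ i, i ≠ p ∧ i ≠ q → glue S (a, c) i = glue S (a', c') i) ↔
      a = a' ∧ (∀ i, i ≠ p ∧ i ≠ q → glue S (0, c) i = glue S (0, c') i) := by
    refine ⟨fun h => ⟨?_, fun i hi => ?_⟩, fun ⟨hc, h⟩ i hi => ?_⟩
    · ext i
      have := h i ⟨fun e => hp (e ▸ i.2), fun e => hq (e ▸ i.2)⟩
      simpa [glue_apply, i.2] using congrArg Fin.val this
    · have := h i hi
      by_cases hS : i ∈ S <;> simp_all [glue_apply]
    · have := h i hi
      by_cases hS : i ∈ S <;> simp_all [glue_apply]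
  simp only [submatrix_apply, kroneckerMap_apply, embed2_apply, h, one_apply, ite_and]
  split_ifs <;> simp [glue_apply, hp, hq]

lemma submatrix_glue_conj (U : Matrix (Fin n → Fin 2) (Fin n → Fin 2) ℂ) :
    (U * ρ * Uᴴ).submatrix (glue S) (glue S) =
      U.submatrix (glue S) (glue S) * ρ.submatrix (glue S) (glue S) *
        (U.submatrix (glue S) (glue S))ᴴ := by
  rw [conjTranspose_submatrix, submatrix_mul_equiv, submatrix_mul_equiv]

lemma vN_red_conj_of_mem (hpq : p ≠ q) (hu : u ∈ unitaryGroup (Fin 2 × Fin 2) ℂ)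
    (hρ : ρ.PosSemidef) (hp : p ∈ S) (hq : q ∈ S) :
    vN (red S (embed2 p q u * ρ * (embed2 p q u)ᴴ)) = vN (red S ρ) := by
  have hU := submatrix_mem_unitaryGroup (embed2_mem_unitaryGroup hpq hu) (glue S)
  rw [embed2_submatrix_glue_of_mem hp hq] at hU
  rw [red_eq_ptrace, submatrix_glue_conj, embed2_submatrix_glue_of_mem hp hq,
    ptrace_kronecker_one_conj, ← red_eq_ptrace]
  exact vN_unitary_conj (red_posSemidef S hρ).1 (mem_unitaryGroup_of_kronecker_one hU)

lemma red_conj_of_notMem (hpq : p ≠ q) (hu : u ∈ unitaryGroup (Fin 2 × Fin 2) ℂ)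
    (hp : p ∉ S) (hq : q ∉ S) :
    red S (embed2 p q u * ρ * (embed2 p q u)ᴴ) = red S ρ := by
  have hU := submatrix_mem_unitaryGroup (embed2_mem_unitaryGroup hpq hu) (glue S)
  rw [embed2_submatrix_glue_of_notMem hp hq] at hU
  rw [red_eq_ptrace, submatrix_glue_conj, embed2_submatrix_glue_of_notMem hp hq,
    ptrace_one_kronecker_conj (mem_unitaryGroup_of_one_kronecker hU), ← red_eq_ptrace]

/-- Extension of a configuration of the qubits in `T` by the value `b` on a further qubit. -/
def extend (T S : Finset (Fin n)) (b : Fin 2) (a : {i // i ∈ T} → Fin 2) :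
    {i // i ∈ S} → Fin 2 :=
  fun i => if h : i.1 ∈ T then a ⟨i.1, h⟩ else b

lemma bijective_extend {T : Finset (Fin n)} (hp : p ∉ T) (hS : S = insert p T) :
    Function.Bijective (Sum.elim (extend T S 0) (extend T S 1)) := by
  subst hS
  have hval (b : Fin 2) (a : {i // i ∈ T} → Fin 2) :
      extend T (insert p T) b a ⟨p, Finset.mem_insert_self p T⟩ = b := by simp [extend, hp]
  have hinj (b : Fin 2) : Function.Injective (extend T (insert p T) b) := by
    intro a a' h
    ext i
    simpa [extend] using congrArg Fin.val (congrFun h ⟨i.1, Finset.mem_insert_of_mem i.2⟩)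
  refine ⟨(hinj 0).sumElim (hinj 1) fun a a' h => ?_, fun x => ?_⟩
  · simpa [hval] using congrFun h ⟨p, Finset.mem_insert_self p T⟩
  · have hx : extend T (insert p T) (x ⟨p, Finset.mem_insert_self p T⟩)
        (fun i => x ⟨i.1, Finset.mem_insert_of_mem i.2⟩) = x := by
      ext ⟨i, hi⟩
      obtain rfl | hi := Finset.mem_insert.mp hi
      · simp [extend, hp]
      · simp [extend, hi]
    obtain h | h : x ⟨p, Finset.mem_insert_self p T⟩ = 0 ∨
        x ⟨p, Finset.mem_insert_self p T⟩ = 1 := by omega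
    · exact ⟨Sum.inl fun i => x ⟨i.1, Finset.mem_insert_of_mem i.2⟩, by rw [h] at hx; exact hx⟩
    · exact ⟨Sum.inr fun i => x ⟨i.1, Finset.mem_insert_of_mem i.2⟩, by rw [h] at hx; exact hx⟩

lemma red_eq_add_red_insert {T : Finset (Fin n)} (hp : p ∉ T) (hS : S = insert p T) :
    red T ρ = (red S ρ).submatrix (extend T S 0) (extend T S 0) +
      (red S ρ).submatrix (extend T S 1) (extend T S 1) := by
  subst hS
  ext a a'
  simp only [red, Matrix.add_apply, submatrix_apply, of_apply]
  rw [← Finset.sum_add_distrib]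
  refine Finset.sum_congr rfl fun z _ => ?_
  have hiff (b : Fin 2) : (fun i : {i // i ∈ insert p T} => z i.1) = extend T (insert p T) b a ↔
      z p = b ∧ (fun i : {i // i ∈ T} => z i.1) = a := by
    refine ⟨fun h => ⟨?_, funext fun i => ?_⟩, fun ⟨h, h'⟩ => funext fun ⟨i, hi⟩ => ?_⟩
    · simpa [extend, hp] using congrFun h ⟨p, Finset.mem_insert_self p T⟩
    · simpa [extend] using congrFun h ⟨i.1, Finset.mem_insert_of_mem i.2⟩
    · by_cases hiT : i ∈ T
      · simpa [extend, hiT] using congrFun h' ⟨i, hiT⟩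
      · obtain rfl := (Finset.mem_insert.mp hi).resolve_right hiT
        simpa [extend, hiT] using h
  have hext :
      (fun j => if h : j ∈ insert p T then extend T (insert p T) (z p) a' ⟨j, h⟩ else z j) =
      fun j => if h : j ∈ T then a' ⟨j, h⟩ else z j := by
    ext j
    by_cases hj : j ∈ T
    · simp [extend, hj]
    · by_cases hjp : j = p
      · subst hjp; simp [extend, hj]
      · simp [hj, hjp]
  simp only [hiff]
  obtain h | h : z p = 0 ∨ z p = 1 := by omega
  all_goals
    rw [h] at hext
    simp only [h, hext, true_and, zero_ne_one, one_ne_zero, false_and, if_false, add_zero, zero_add]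

lemma abs_vN_red_insert_sub_le {T : Finset (Fin n)} (hp : p ∉ T) (hS : S = insert p T)
    (hρ : ρ.PosSemidef) (hρtr : ρ.trace = 1) :
    |vN (red S ρ) - vN (red T ρ)| ≤ Real.log 2 := by
  have hPSD := red_posSemidef S hρ
  let e := Equiv.ofBijective _ (bijective_extend hp hS)
  have hsum := red_eq_add_red_insert (ρ := ρ) hp hS
  have hM := hPSD.submatrix e
  have htr := trace_red T ρ
  rw [hρtr] at htr
  rw [← vN_submatrix_equiv hPSD.1 e, hsum]
  rw [hsum] at htr
  rw [← fromBlocks_toBlocks ((red S ρ).submatrix e e)] at hM ⊢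
  refine (abs_vN_fromBlocks_sub_le hM).trans_eq ?_
  change ((red S ρ).submatrix (extend T S 0) (extend T S 0) +
      (red S ρ).submatrix (extend T S 1) (extend T S 1)).trace.re * _ = _
  rw [htr]
  simp

lemma abs_vN_red_conj_sub_le {T : Finset (Fin n)} {r : Fin n} (hr : r ∉ T) (hS : S = insert r T)
    (hp : p ∉ T) (hq : q ∉ T) (hpq : p ≠ q) (hu : u ∈ unitaryGroup (Fin 2 × Fin 2) ℂ)
    (hρ : ρ.PosSemidef) (hρtr : ρ.trace = 1) :
    |vN (red S (embed2 p q u * ρ * (embed2 p q u)ᴴ)) - vN (red S ρ)| ≤ 2 * Real.log 2 := by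
  have h1 := abs_vN_red_insert_sub_le hr hS hρ hρtr
  have h2 := abs_vN_red_insert_sub_le hr hS
    (hρ.mul_mul_conjTranspose_same (embed2 p q u)) (by
      rw [trace_mul_comm, ← mul_assoc, ← star_eq_conjTranspose,
        mem_unitaryGroup_iff'.mp (embed2_mem_unitaryGroup hpq hu), one_mul, hρtr])
  rw [red_conj_of_notMem hpq hu hp hq] at h2
  rw [abs_le] at *
  constructor <;> linarith

end Qubits

/-- A two-qubit unitary acting on neighboring qubits `k`, `k+1`
(1-indexed, `1 ≤ k ≤ n−1`) changes the entanglement measure `E` by at most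
`8·log 2/(n−1)`. -/
theorem stmt19 (hn : 2 ≤ n)
    (ρ : Matrix (Fin n → Fin 2) (Fin n → Fin 2) ℂ)
    (hρ : ρ.PosSemidef) (hρtr : ρ.trace = 1)
    (k : ℕ) (hk1 : 1 ≤ k) (hk2 : k ≤ n - 1)
    (u : Matrix (Fin 2 × Fin 2) (Fin 2 × Fin 2) ℂ)
    (hu : u ∈ Matrix.unitaryGroup (Fin 2 × Fin 2) ℂ) :
    |Emeas (embed2 (⟨k - 1, by omega⟩ : Fin n) (⟨k, by omega⟩ : Fin n) u * ρ *
        (embed2 (⟨k - 1, by omega⟩ : Fin n) (⟨k, by omega⟩ : Fin n) u)ᴴ) - Emeas ρ| ≤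
      8 * Real.log 2 / ((n : ℝ) - 1) := by
  set p : Fin n := ⟨k - 1, by omega⟩ with hpdef
  set q : Fin n := ⟨k, by omega⟩ with hqdef
  have hpq : p ≠ q := by simp only [hpdef, hqdef, ne_eq, Fin.mk.injEq]; omega
  have hlog : 0 ≤ Real.log 2 := Real.log_nonneg (by norm_num)
  have hn1 : (0 : ℝ) < (n : ℝ) - 1 := by
    have : (2 : ℝ) ≤ n := by exact_mod_cast hn
    linarith
  have hglobal := vN_unitary_conj hρ.1 (embed2_mem_unitaryGroup hpq hu)
  have hne (j : ℕ) (hj : j ≠ k) :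
      mutInfo j (embed2 p q u * ρ * (embed2 p q u)ᴴ) - mutInfo j ρ = 0 := by
    rw [mutInfo, mutInfo, hglobal]
    obtain hlt | hgt := lt_or_gt_of_ne hj
    · rw [red_conj_of_notMem hpq hu, vN_red_conj_of_mem hpq hu hρ, sub_self]
      all_goals simp only [hpdef, hqdef, Finset.mem_filter, Finset.mem_univ, true_and]; omega
    · rw [vN_red_conj_of_mem hpq hu hρ, red_conj_of_notMem hpq hu, sub_self]
      all_goals simp only [hpdef, hqdef, Finset.mem_filter, Finset.mem_univ, true_and]; omega
  have hk : |mutInfo k (embed2 p q u * ρ * (embed2 p q u)ᴴ) - mutInfo k ρ| ≤ 8 * Real.log 2 := by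
    have hA := abs_vN_red_conj_sub_le (S := Finset.univ.filter fun i : Fin n => (i : ℕ) < k)
      (T := Finset.univ.filter fun i : Fin n => (i : ℕ) < k - 1) (r := p) (p := p) (q := q)
      (by simp [hpdef]) (by ext i; simp [hpdef, Fin.ext_iff]; omega)
      (by simp [hpdef]) (by simp [hqdef]) hpq hu hρ hρtr
    have hB := abs_vN_red_conj_sub_le (S := Finset.univ.filter fun i : Fin n => k ≤ (i : ℕ))
      (T := Finset.univ.filter fun i : Fin n => k + 1 ≤ (i : ℕ)) (r := q) (p := p) (q := q)
      (by simp [hqdef]) (by ext i; simp [hqdef, Fin.ext_iff]; omega)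
      (by simp [hpdef]) (by simp [hqdef]) hpq hu hρ hρtr
    rw [mutInfo, mutInfo, hglobal]
    rw [abs_le] at *
    constructor <;> linarith
  rw [Emeas, Emeas, ← mul_sub, ← Finset.sum_sub_distrib,
    Finset.sum_eq_single_of_mem k (Finset.mem_Icc.mpr ⟨hk1, hk2⟩) fun j _ hj => hne j hj,
    abs_mul, abs_of_pos (one_div_pos.mpr hn1), one_div, inv_mul_eq_div]
  gcongr

end
end
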